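/- arXiv:2401.02602 — 6 statements merged into one kernel-verified Lean document; each statement's English description precedes it below -/
import Mathlib

section
/- Let τ be the constructive abstraction function determined by an admissible intervariable clustering ℂ and intravariable clustering 𝔻 of the low-level variables V_L, and let M_L and M_H be finite recursive SCMs over V_L and over the high-level variables V_H respectively. Then M_H is L3-τ consistent with M_L if and only if there exist finite recursive SCMs M_L' over V_L and M_H' over V_H with L3(M_L') = L3(M_L) and L3(M_H') = L3(M_H) such that M_H' is a constructive τ-abstraction of M_L'. -/
set_option linter.unusedVariables false

open Classical

universe u

/-- A finite recursive structural causal model over endogenous variables `Fin n`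
with finite domains `D i`. `Pa i ⊆ {0, …, i-1}` are the endogenous parents of `i`,
`U` is the finite exogenous sample space with probability mass function `P`, and
`mech i` is the mechanism of variable `i`. -/
structure SCM (n : ℕ) (D : Fin n → Type u) where
  U : Type u
  fintypeU : Fintype U
  P : U → ℝ
  P_nonneg : ∀ u, 0 ≤ P u
  P_sum : (@Finset.univ U fintypeU).sum P = 1
  Pa : Fin n → Finset (Fin n)
  Pa_lt : ∀ i : Fin n, ∀ j ∈ Pa i, j < i
  mech : ∀ i : Fin n, (∀ j ∈ Pa i, D j) → U → D i

attribute [instance] SCM.fintypeU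

namespace SCM

variable {n : ℕ} {D : Fin n → Type u}

/-- The potential response `V_[x](u)`: the value of each endogenous variable under the
intervention fixing the variables of `X` to `x`, with exogenous value `u`. -/
noncomputable def resp (M : SCM n D) (X : Finset (Fin n)) (x : ∀ i ∈ X, D i)
    (u : M.U) : (i : Fin n) → D i
  | i =>
    if h : i ∈ X then x i h
    else M.mech i (fun j hj => M.resp X x u j) u
termination_by i => i.1
decreasing_by exact M.Pa_lt i j hj

end SCM

/-- A counterfactual query: `k` terms, the `j`-th asking that the variables of `Y j`
take the values `y j` under the intervention fixing `X j` to `x j`. -/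
structure CtfQuery (n : ℕ) (D : Fin n → Type u) where
  k : ℕ
  Y : Fin k → Finset (Fin n)
  X : Fin k → Finset (Fin n)
  x : ∀ j : Fin k, ∀ i ∈ X j, D i
  y : ∀ j : Fin k, ∀ i ∈ Y j, D i

/-- The counterfactual probability `P^M(Y¹_[x¹]=y¹, …, Y^k_[x^k]=y^k)`. -/
noncomputable def SCM.ctfProb {n : ℕ} {D : Fin n → Type u} (M : SCM n D)
    (q : CtfQuery n D) : ℝ :=
  ∑ u : M.U,
    if ∀ (j : Fin q.k) (i : Fin n) (h : i ∈ q.Y j),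
        M.resp (q.X j) (q.x j) u i = q.y j i h
    then M.P u else 0

/-- `L3(M) = L3(M')`: the two SCMs (over the same variables and domains) assign
equal probability to every counterfactual query. -/
def L3eq {n : ℕ} {D : Fin n → Type u} (M M' : SCM n D) : Prop :=
  ∀ q : CtfQuery n D, M.ctfProb q = M'.ctfProb q

/-- An intervariable clustering: a partition `C 0, …, C (m-1)` of a subset of the
low-level variables `Fin n` into nonempty, pairwise disjoint clusters, listed in
order. -/
structure InterClustering (n : ℕ) where
  m : ℕ
  C : Fin m → Finset (Fin n)
  nonempty : ∀ i, (C i).Nonempty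
  disj : ∀ i j : Fin m, i ≠ j → Disjoint (C i) (C j)

/-- Admissibility of an intervariable clustering with respect to an SCM: in the given
ordering of the clusters, every endogenous parent of a variable in a cluster lies in
the same cluster or an earlier one. -/
def InterClustering.AdmissibleFor {n : ℕ} {D : Fin n → Type u}
    (cl : InterClustering n) (M : SCM n D) : Prop :=
  ∀ i : Fin cl.m, ∀ v ∈ cl.C i, ∀ p ∈ M.Pa v, ∃ i' : Fin cl.m, i' ≤ i ∧ p ∈ cl.C i'

/-- Admissibility of the clustering itself: the given ordering of the clusters is
compatible with the (topological) ordering of the low-level variables, so that in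
any SCM a variable of an earlier cluster may serve as a parent of a variable of a
later cluster. -/
def InterClustering.OrderedAdmissible {n : ℕ} (cl : InterClustering n) : Prop :=
  ∀ a b : Fin cl.m, a < b → ∀ v ∈ cl.C a, ∀ w ∈ cl.C b, v < w

/-- An intravariable clustering relative to the intervariable clustering `cl`:
for each cluster `i`, a partition of the joint domain `D_{C i}` of the cluster into
nonempty blocks, presented as a surjection `tc i` onto the (finite) set of blocks
`B i`; `B i` is the domain of the `i`-th high-level variable, and `tc i c` is the
unique block containing `c`. -/
structure IntraClustering {n : ℕ} (D : Fin n → Type u) (cl : InterClustering n) where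
  B : Fin cl.m → Type u
  fintypeB : ∀ i, Fintype (B i)
  tc : ∀ i : Fin cl.m, (∀ j ∈ cl.C i, D j) → B i
  tc_surj : ∀ i, Function.Surjective (tc i)

attribute [instance] IntraClustering.fintypeB

namespace IntraClustering

variable {n : ℕ} {D : Fin n → Type u} {cl : InterClustering n}

/-- The constructive abstraction function `τ` determined by the clusterings, on full
low-level assignments. -/
def tau (intra : IntraClustering D cl) (v : ∀ i : Fin n, D i) :
    ∀ i : Fin cl.m, intra.B i :=
  fun i => intra.tc i (fun j _ => v j)

/-- `τ` applied to a value of a union of clusters (`S` is the set of cluster indices,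
the union of clusters being `S.biUnion cl.C`). -/
def tauOn (intra : IntraClustering D cl) (S : Finset (Fin cl.m))
    (x : ∀ v ∈ S.biUnion cl.C, D v) : ∀ i ∈ S, intra.B i :=
  fun i hi => intra.tc i (fun j hj => x j (Finset.mem_biUnion.mpr ⟨i, hi, hj⟩))

end IntraClustering

/-- A low-level counterfactual query whose term sets and intervened sets are unions of
clusters, together with a high-level outcome.  `Ys j` and `Xs j` are the sets of
cluster indices of the `j`-th term, `x j` is the low-level intervention value on the
union of the clusters of `Xs j`, and `yH j` is the high-level outcome of the term. -/
structure AbsQuery {n : ℕ} (D : Fin n → Type u) (cl : InterClustering n)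
    (intra : IntraClustering D cl) where
  k : ℕ
  Ys : Fin k → Finset (Fin cl.m)
  Xs : Fin k → Finset (Fin cl.m)
  x  : ∀ j : Fin k, ∀ v ∈ (Xs j).biUnion cl.C, D v
  yH : ∀ j : Fin k, ∀ i ∈ Ys j, intra.B i

section Values

variable {n : ℕ} {D : Fin n → Type u} {cl : InterClustering n}

/-- The value of the low-level query `Q` under the low-level SCM `M`: the sum, over
all low-level outcome values `y_{L,*}` mapping to the high-level outcome `y_{H,*}`
under `τ`, of the counterfactual probability
`P^M(Y_{L,1[x_{L,1}]} = y_{L,1}, …, Y_{L,k[x_{L,k}]} = y_{L,k})`. -/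
noncomputable def lowValue [∀ i, Fintype (D i)] (M : SCM n D)
    (intra : IntraClustering D cl) (q : AbsQuery D cl intra) : ℝ :=
  ∑ yL : ∀ j : Fin q.k, ∀ v ∈ (q.Ys j).biUnion cl.C, D v,
    if ∀ (j : Fin q.k) (i : Fin cl.m) (hi : i ∈ q.Ys j),
        intra.tauOn (q.Ys j) (yL j) i hi = q.yH j i hi
    then M.ctfProb ⟨q.k, fun j => (q.Ys j).biUnion cl.C,
        fun j => (q.Xs j).biUnion cl.C, q.x, yL⟩
    else 0

/-- The value of the high-level counterpart `τ(Q)` under a high-level SCM `MH`: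
`P^{MH}(τ(Y_{L,1})_{[τ(x_{L,1})]} = y_{H,1}, …)`. -/
noncomputable def highValue (intra : IntraClustering D cl)
    (MH : SCM cl.m intra.B) (q : AbsQuery D cl intra) : ℝ :=
  MH.ctfProb ⟨q.k, q.Ys, q.Xs, fun j => intra.tauOn (q.Xs j) (q.x j), q.yH⟩

/-- `MH` is `Q`-`τ` consistent with `ML`: the value of `Q` induced by `ML` equals the
value of `τ(Q)` induced by `MH`. -/
def QTauConsistent [∀ i, Fintype (D i)] (ML : SCM n D)
    (intra : IntraClustering D cl) (MH : SCM cl.m intra.B)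
    (q : AbsQuery D cl intra) : Prop :=
  lowValue ML intra q = highValue intra MH q

/-- `MH` is `L3`-`τ` consistent with `ML`: `Q`-`τ` consistency holds for every query. -/
def L3TauConsistent [∀ i, Fintype (D i)] (ML : SCM n D)
    (intra : IntraClustering D cl) (MH : SCM cl.m intra.B) : Prop :=
  ∀ q : AbsQuery D cl intra, QTauConsistent ML intra MH q

/-- The abstract invariance condition (AIC): whenever two full low-level assignments
`v1, v2` map to the same high-level value under `τ`, then for every exogenous value
`u` and every cluster `i`, the tuple of mechanism outputs of the cluster's variables
on the `v1`-parent values and on the `v2`-parent values lie in the same block. -/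
def AIC (ML : SCM n D) (intra : IntraClustering D cl) : Prop :=
  ∀ v1 v2 : ∀ i : Fin n, D i, intra.tau v1 = intra.tau v2 →
    ∀ u : ML.U, ∀ i : Fin cl.m,
      intra.tc i (fun j _ => ML.mech j (fun p _ => v1 p) u)
        = intra.tc i (fun j _ => ML.mech j (fun p _ => v2 p) u)

end Values

/-- `MH` is a constructive `τ`-abstraction of `ML` (Beckers–Halpern, specialised to
the constructive abstraction function `τ` determined by the clusterings):
(i) `τ` is surjective;
(ii) there is a surjective map `tU` on the exogenous spaces such that `P_{MH}` is the
pushforward of `P_{ML}` under `tU` and `τ(V_{L[x_L]}(u)) = V_{H[ω_τ(X_L ← x_L)]}(tU u)`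
for every exogenous `u` and every allowed low-level intervention (one whose
intervened set is a union of clusters, with `ω_τ(X_L ← x_L) = (τ(X_L) ← τ(x_L))`);
(iii) `ω_τ(I_L) = I_H`, i.e. every high-level intervention arises as `ω_τ` of an
allowed low-level intervention. -/
def ConstructiveTauAbstraction {n : ℕ} {D : Fin n → Type u}
    {cl : InterClustering n} (intra : IntraClustering D cl)
    (ML : SCM n D) (MH : SCM cl.m intra.B) : Prop :=
  Function.Surjective intra.tau ∧
  (∃ tU : ML.U → MH.U, Function.Surjective tU ∧
    (∀ uH : MH.U, MH.P uH = ∑ uL : ML.U, if tU uL = uH then ML.P uL else 0) ∧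
    (∀ (S : Finset (Fin cl.m)) (xL : ∀ v ∈ S.biUnion cl.C, D v) (uL : ML.U),
      intra.tau (ML.resp (S.biUnion cl.C) xL uL)
        = MH.resp S (intra.tauOn S xL) (tU uL))) ∧
  (∀ (S : Finset (Fin cl.m)) (xH : ∀ i ∈ S, intra.B i),
    ∃ xL : ∀ v ∈ S.biUnion cl.C, D v,
      ∀ i (hi : i ∈ S), intra.tauOn S xL i hi = xH i hi)

namespace SCM

variable {n : ℕ} {D : Fin n → Type u}

theorem sum_fiber_ne_zero_iff (M : SCM n D) {W : Type u} (f : M.U → W) (w : W) :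
    (∑ u, if f u = w then M.P u else 0) ≠ 0 ↔ ∃ u, M.P u ≠ 0 ∧ f u = w := by
  have hnn : ∀ u ∈ Finset.univ, 0 ≤ if f u = w then M.P u else 0 := by
    intro u _
    split_ifs
    exacts [M.P_nonneg u, le_rfl]
  rw [Ne, Finset.sum_eq_zero_iff_of_nonneg hnn]
  simp only [Finset.mem_univ, forall_const, not_forall, ite_eq_right_iff]
  exact exists_congr fun u => ⟨fun ⟨h, h'⟩ => ⟨h', h⟩, fun ⟨h, h'⟩ => ⟨h', h⟩⟩

/-- The values of `f : M.U → W` attained with positive probability. -/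
abbrev FiberSupport (M : SCM n D) {W : Type u} (f : M.U → W) : Type u :=
  {w : W // ∃ u, M.P u ≠ 0 ∧ f u = w}

theorem sum_fiberSupport (M : SCM n D) {W : Type u} [Fintype W] (f : M.U → W) (g : M.U → ℝ)
    (hg : ∀ u, M.P u = 0 → g u = 0) :
    (∑ w : M.FiberSupport f, ∑ u, if f u = w.1 then g u else 0) = ∑ u, g u := by
  rw [Finset.sum_comm]
  refine Finset.sum_congr rfl fun u _ => ?_
  by_cases hu : M.P u = 0
  · simp [hg u hu]
  · rw [Finset.sum_eq_single (⟨f u, u, hu, rfl⟩ : M.FiberSupport f)]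
    · simp
    · intro w _ hw
      rw [if_neg fun h => hw (Subtype.ext h.symm)]
    · simp

/-- The SCM whose exogenous space consists of the values of `f` attained with positive
probability, each carrying the mass of its fiber and acting as one of its preimages. -/
noncomputable def pushforward (M : SCM n D) {W : Type u} [Fintype W] (f : M.U → W) :
    SCM n D where
  U := M.FiberSupport f
  fintypeU := inferInstance
  P w := ∑ u, if f u = w.1 then M.P u else 0
  P_nonneg w := Finset.sum_nonneg fun u _ => by
    split_ifs
    exacts [M.P_nonneg u, le_rfl]
  P_sum := (M.sum_fiberSupport f M.P fun _ h => h).trans M.P_sum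
  Pa := M.Pa
  Pa_lt := M.Pa_lt
  mech i p w := M.mech i p w.2.choose

theorem resp_eq_dite (M : SCM n D) (X : Finset (Fin n)) (x : ∀ i ∈ X, D i) (u : M.U)
    (i : Fin n) :
    M.resp X x u i = if h : i ∈ X then x i h else M.mech i (fun j _ => M.resp X x u j) u := by
  rw [resp]

theorem resp_pushforward (M : SCM n D) {W : Type u} [Fintype W] (f : M.U → W)
    (X : Finset (Fin n)) (x : ∀ i ∈ X, D i) (w : M.FiberSupport f) :
    (M.pushforward f).resp X x w = M.resp X x w.2.choose := by
  funext i
  induction i using WellFoundedLT.induction with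
  | ind i ih =>
    refine ((M.pushforward f).resp_eq_dite X x w i).trans
      (Eq.trans ?_ (M.resp_eq_dite X x w.2.choose i).symm)
    split_ifs with h
    · rfl
    · change M.mech i _ _ = _
      congr 1
      funext j hj
      exact ih j (M.Pa_lt i j hj)

theorem L3eq_pushforward (M : SCM n D) {W : Type u} [Fintype W] (f : M.U → W)
    (hf : ∀ u u', f u = f u' → ∀ X x, M.resp X x u = M.resp X x u') :
    L3eq (M.pushforward f) M := by
  intro q
  unfold ctfProb
  rw [← M.sum_fiberSupport f (fun u => if ∀ (j : Fin q.k) (i : Fin n) (h : i ∈ q.Y j),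
        M.resp (q.X j) (q.x j) u i = q.y j i h then M.P u else 0) (by simp +contextual)]
  refine Finset.sum_congr rfl fun (w : M.FiberSupport f) _ => ?_
  have hr : ∀ u, f u = w.1 → ∀ X x, (M.pushforward f).resp X x w = M.resp X x u :=
    fun u hu X x => (M.resp_pushforward f X x w).trans
      (hf _ _ (w.2.choose_spec.2.trans hu.symm) X x)
  split_ifs with hE
  · refine Finset.sum_congr rfl fun u _ => ?_
    by_cases h : f u = w.1
    · rw [if_pos h, if_pos h, if_pos]
      intro j i hi
      rw [← hE j i hi, hr u h]
    · rw [if_neg h, if_neg h]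
  · refine (Finset.sum_eq_zero fun u _ => ?_).symm
    by_cases h : f u = w.1
    · rw [if_pos h, if_neg]
      intro hE'
      refine hE fun j i hi => ?_
      rw [← hE' j i hi, hr u h]
    · rw [if_neg h]

end SCM

section Abstraction

variable {n : ℕ} {D : Fin n → Type u} {cl : InterClustering n}

theorem IntraClustering.exists_lift [∀ i, Nonempty (D i)] (intra : IntraClustering D cl)
    (b : ∀ i, intra.B i) : ∃ v, intra.tau v = b := by
  choose c hc using fun i => intra.tc_surj i (b i)
  refine ⟨fun v => if h : ∃ i, v ∈ cl.C i then c h.choose v h.choose_spec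
    else Classical.arbitrary _, funext fun i => ?_⟩
  rw [← hc i]
  unfold IntraClustering.tau
  congr 1
  funext j hj
  have h : ∃ i, j ∈ cl.C i := ⟨i, hj⟩
  refine (dif_pos h).trans ?_
  have hi : h.choose = i := by
    by_contra hne
    exact Finset.disjoint_left.mp (cl.disj _ _ hne) h.choose_spec hj
  have key : ∀ (i' : Fin cl.m) (h' : j ∈ cl.C i'), i' = i → c i' j h' = c i j hj := by
    rintro i' h' rfl
    rfl
  exact key _ _ hi

theorem IntraClustering.tauOn_surjective [∀ i, Nonempty (D i)] (intra : IntraClustering D cl)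
    (S : Finset (Fin cl.m)) : Function.Surjective (intra.tauOn S) := by
  intro xH
  have hB : ∀ i, Nonempty (intra.B i) := fun i =>
    ⟨intra.tc i fun j _ => Classical.arbitrary (D j)⟩
  obtain ⟨v, hv⟩ := intra.exists_lift fun i =>
    if h : i ∈ S then xH i h else Classical.arbitrary _
  refine ⟨fun j _ => v j, ?_⟩
  funext i hi
  have := congrFun hv i
  rw [dif_pos hi] at this
  exact this

theorem lowValue_eq_sum [∀ i, Fintype (D i)] (M : SCM n D) (intra : IntraClustering D cl)
    (q : AbsQuery D cl intra) :
    lowValue M intra q = ∑ u, if ∀ (j : Fin q.k) (i : Fin cl.m) (hi : i ∈ q.Ys j),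
      intra.tau (M.resp ((q.Xs j).biUnion cl.C) (q.x j) u) i = q.yH j i hi
      then M.P u else 0 := by
  unfold lowValue SCM.ctfProb
  have : ∀ yL : (∀ j : Fin q.k, ∀ v ∈ (q.Ys j).biUnion cl.C, D v), ∀ (p : Prop) [Decidable p],
      (if p then ∑ u, (if ∀ (j : Fin q.k) (i : Fin n) (h : i ∈ (q.Ys j).biUnion cl.C),
        M.resp ((q.Xs j).biUnion cl.C) (q.x j) u i = yL j i h then M.P u else 0) else 0)
      = ∑ u, if yL = (fun j i _ => M.resp ((q.Xs j).biUnion cl.C) (q.x j) u i)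
        then (if p then M.P u else 0) else 0 := by
    intro yL p _
    by_cases hp : p
    · simp only [hp, if_true]
      refine Finset.sum_congr rfl fun u _ => if_congr ?_ rfl rfl
      constructor
      · intro h
        funext j i hi
        exact (h j i hi).symm
      · rintro rfl j i hi
        rfl
    · simp [hp]
  simp_rw [this]
  rw [Finset.sum_comm]
  refine Finset.sum_congr rfl fun u _ => ?_
  rw [Finset.sum_ite_eq' Finset.univ _ _, if_pos (Finset.mem_univ _)]
  rfl

theorem ConstructiveTauAbstraction.l3TauConsistent [∀ i, Fintype (D i)]
    {intra : IntraClustering D cl} {ML : SCM n D} {MH : SCM cl.m intra.B}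
    (h : ConstructiveTauAbstraction intra ML MH) : L3TauConsistent ML intra MH := by
  obtain ⟨-, ⟨tU, -, hP, hresp⟩, -⟩ := h
  intro q
  unfold QTauConsistent highValue SCM.ctfProb
  rw [lowValue_eq_sum]
  simp_rw [hP, hresp]
  have key : ∀ (p : MH.U → Prop) [DecidablePred p], (∑ uH, if p uH then
      ∑ uL, (if tU uL = uH then ML.P uL else 0) else 0) =
      ∑ uL, if p (tU uL) then ML.P uL else 0 := by
    intro p _
    have hp : ∀ uH, (if p uH then ∑ uL, (if tU uL = uH then ML.P uL else 0) else 0) =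
        ∑ uL, if tU uL = uH then (if p (tU uL) then ML.P uL else 0) else 0 := by
      intro uH
      split_ifs with h
      · refine Finset.sum_congr rfl fun uL _ => ?_
        split_ifs <;> simp_all
      · refine (Finset.sum_eq_zero fun uL _ => ?_).symm
        split_ifs <;> simp_all
    simp_rw [hp]
    rw [Finset.sum_comm]
    exact Finset.sum_congr rfl fun uL _ => by simp
  exact (key fun u => ∀ (j : Fin q.k) (i : Fin cl.m) (hi : i ∈ q.Ys j),
    MH.resp (q.Xs j) (intra.tauOn (q.Xs j) (q.x j)) u i = q.yH j i hi).symm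

theorem L3TauConsistent.congr [∀ i, Fintype (D i)] {intra : IntraClustering D cl}
    {ML ML' : SCM n D} {MH MH' : SCM cl.m intra.B} (hL : L3eq ML' ML) (hH : L3eq MH' MH)
    (h : L3TauConsistent ML' intra MH') : L3TauConsistent ML intra MH := by
  intro q
  have := h q
  unfold QTauConsistent lowValue highValue at *
  simp_rw [hL _, hH _] at this
  exact this

/-- The low-level interventions whose intervened set is a union of clusters. -/
abbrev ClusterIntervention (D : Fin n → Type u) (cl : InterClustering n) : Type u :=
  Σ S : Finset (Fin cl.m), ∀ v ∈ S.biUnion cl.C, D v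

/-- The joint high-level outcomes, one for each cluster intervention. -/
def JointResponse (intra : IntraClustering D cl) : Type u :=
  ClusterIntervention D cl → ∀ i, intra.B i

noncomputable instance [∀ i, Fintype (D i)] (intra : IntraClustering D cl) :
    Fintype (JointResponse intra) :=
  inferInstanceAs (Fintype (ClusterIntervention D cl → ∀ i, intra.B i))

/-- The abstracted low-level responses to all cluster interventions. -/
noncomputable def lowResponse (intra : IntraClustering D cl) (ML : SCM n D) (u : ML.U) :
    JointResponse intra :=
  fun κ => intra.tau (ML.resp (κ.1.biUnion cl.C) κ.2 u)

/-- The high-level responses to the abstractions of all cluster interventions. -/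
noncomputable def highResponse (intra : IntraClustering D cl) (MH : SCM cl.m intra.B)
    (u : MH.U) : JointResponse intra :=
  fun κ => MH.resp κ.1 (intra.tauOn κ.1 κ.2) u

theorem L3TauConsistent.sum_lowResponse_eq [∀ i, Fintype (D i)] {intra : IntraClustering D cl}
    {ML : SCM n D} {MH : SCM cl.m intra.B} (h : L3TauConsistent ML intra MH)
    (r : JointResponse intra) :
    (∑ u, if lowResponse intra ML u = r then ML.P u else 0) =
      ∑ u, if highResponse intra MH u = r then MH.P u else 0 := by
  let e := Fintype.equivFin (ClusterIntervention D cl)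
  have hq := h ⟨Fintype.card (ClusterIntervention D cl), fun _ => Finset.univ,
    fun j => (e.symm j).1, fun j => (e.symm j).2, fun j i _ => r (e.symm j) i⟩
  have hr : ∀ g : JointResponse intra,
      (∀ j i, i ∈ (Finset.univ : Finset (Fin cl.m)) → g (e.symm j) i = r (e.symm j) i) ↔
        g = r := by
    intro g
    constructor
    · intro hg
      funext κ i
      have := hg (e κ) i (Finset.mem_univ i)
      rwa [e.symm_apply_apply] at this
    · rintro rfl _ _ _
      rfl
  unfold QTauConsistent at hq
  rw [lowValue_eq_sum] at hq
  refine Eq.trans ?_ (hq.trans ?_)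
  · exact Finset.sum_congr rfl fun u _ => if_congr (hr (lowResponse intra ML u)).symm rfl rfl
  · exact Finset.sum_congr rfl fun u _ => if_congr (hr (highResponse intra MH u)) rfl rfl

theorem resp_eq_of_highResponse_eq [∀ i, Nonempty (D i)] {intra : IntraClustering D cl}
    {MH : SCM cl.m intra.B} {u u' : MH.U}
    (h : highResponse intra MH u = highResponse intra MH u')
    (X : Finset (Fin cl.m)) (x : ∀ i ∈ X, intra.B i) : MH.resp X x u = MH.resp X x u' := by
  obtain ⟨xL, rfl⟩ := intra.tauOn_surjective X x
  exact congrFun h ⟨X, xL⟩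

theorem L3TauConsistent.constructiveTauAbstraction [∀ i, Fintype (D i)] [∀ i, Nonempty (D i)]
    {intra : IntraClustering D cl} {ML : SCM n D} {MH : SCM cl.m intra.B}
    (h : L3TauConsistent ML intra MH) :
    ConstructiveTauAbstraction intra (ML.pushforward id)
      (MH.pushforward (highResponse intra MH)) := by
  have hsupp : ∀ r, (∃ u, ML.P u ≠ 0 ∧ lowResponse intra ML u = r) ↔
      ∃ u, MH.P u ≠ 0 ∧ highResponse intra MH u = r := fun r => by
    rw [← ML.sum_fiber_ne_zero_iff, ← MH.sum_fiber_ne_zero_iff, h.sum_lowResponse_eq]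
  have hid : ∀ w : ML.FiberSupport id, w.2.choose = w.1 := fun w => w.2.choose_spec.2
  have hpos : ∀ w : ML.FiberSupport id, ML.P w.1 ≠ 0 := by
    rintro ⟨_, u, hu, rfl⟩
    exact hu
  let tU : ML.FiberSupport id → MH.FiberSupport (highResponse intra MH) := fun w =>
    ⟨lowResponse intra ML w.1, (hsupp _).mp ⟨w.1, hpos w, rfl⟩⟩
  refine ⟨intra.exists_lift, ⟨tU, ?_, ?_, ?_⟩, ?_⟩
  · rintro ⟨r, hr⟩
    obtain ⟨u, hu, rfl⟩ := (hsupp r).mpr hr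
    exact ⟨⟨u, u, hu, rfl⟩, rfl⟩
  · intro (r : MH.FiberSupport (highResponse intra MH))
    refine Eq.trans (h.sum_lowResponse_eq r.1).symm ?_
    rw [← ML.sum_fiberSupport id
      (fun u => if lowResponse intra ML u = r.1 then ML.P u else 0) (by simp +contextual)]
    refine Finset.sum_congr rfl fun (w : ML.FiberSupport id) _ => ?_
    by_cases hw : tU w = r
    · refine Eq.trans (Finset.sum_congr rfl fun u _ => ?_) (if_pos hw).symm
      by_cases hu : id u = w.1
      · rw [if_pos hu, if_pos hu, if_pos]
        rw [← hw, show u = w.1 from hu]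
      · rw [if_neg hu, if_neg hu]
    · refine Eq.trans (Finset.sum_eq_zero fun u _ => ?_) (if_neg hw).symm
      by_cases hu : id u = w.1
      · rw [if_pos hu, if_neg]
        rw [show u = w.1 from hu]
        exact fun h => hw (Subtype.ext h)
      · rw [if_neg hu]
  · intro S xL (w : ML.FiberSupport id)
    rw [ML.resp_pushforward id, hid]
    refine Eq.trans ?_ (MH.resp_pushforward _ S _ (tU w)).symm
    exact (congrFun (tU w).2.choose_spec.2 ⟨S, xL⟩).symm
  · intro S xH
    obtain ⟨xL, rfl⟩ := intra.tauOn_surjective S xH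
    exact ⟨xL, fun _ _ => rfl⟩

end Abstraction

/-- **Abstraction connection.**
Let `τ` be the constructive abstraction function determined by an admissible
intervariable clustering `cl` and intravariable clustering `intra`, and let `ML`,
`MH` be finite recursive SCMs over the low- and high-level variables respectively.
Then `MH` is `L3`-`τ` consistent with `ML` if and only if there exist SCMs `ML'`,
`MH'` with `L3(ML') = L3(ML)` and `L3(MH') = L3(MH)` such that `MH'` is a
constructive `τ`-abstraction of `ML'`. -/
theorem abstraction_connection {n : ℕ} {D : Fin n → Type u}
    [∀ i, Fintype (D i)] [∀ i, Nonempty (D i)]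
    (cl : InterClustering n) (intra : IntraClustering D cl)
    (ML : SCM n D) (hadm : cl.AdmissibleFor ML)
    (MH : SCM cl.m intra.B) :
    L3TauConsistent ML intra MH ↔
      ∃ (ML' : SCM n D) (MH' : SCM cl.m intra.B),
        L3eq ML' ML ∧ L3eq MH' MH ∧ ConstructiveTauAbstraction intra ML' MH' := by
  constructor
  · intro h
    exact ⟨_, _, ML.L3eq_pushforward id fun u u' hu X x => by rw [show u = u' from hu],
      MH.L3eq_pushforward _ fun u u' hu => resp_eq_of_highResponse_eq hu,
      h.constructiveTauAbstraction⟩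
  · rintro ⟨ML', MH', hL, hH, h⟩
    exact h.l3TauConsistent.congr hL hH
end

section
/- In a finite recursive SCM, let Y ⊆ V and X ⊆ V with X ∩ Y = ∅, let x be a value of X, and let u be an exogenous value. Let Pa(Y) := ⋃_{i∈Y} Pa(i) and let p be the value of Pa(Y) given by the potential response, i.e., p_j = (V_[x](u))_j for each j ∈ Pa(Y). Then Y_[x](u) = Y_[p](u); that is, the potential response of Y under the intervention x equals its potential response under the intervention that fixes the parents of Y to their values in the x-submodel. -/
set_option linter.unusedVariables false

open Classical

universe u

namespace SCM

variable {n : ℕ} {D : Fin n → Type u}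

theorem resp_of_mem (M : SCM n D) {X : Finset (Fin n)} (x : ∀ i ∈ X, D i) (u : M.U)
    {i : Fin n} (hi : i ∈ X) : M.resp X x u i = x i hi := by
  rw [resp, dif_pos hi]

theorem resp_of_notMem (M : SCM n D) {X : Finset (Fin n)} (x : ∀ i ∈ X, D i) (u : M.U)
    {i : Fin n} (hi : i ∉ X) :
    M.resp X x u i = M.mech i (fun j _ => M.resp X x u j) u := by
  rw [resp, dif_neg hi]

end SCM

/-- **Composition.**  In a finite recursive SCM, if `Y` and `X` are
disjoint sets of endogenous variables, `x` a value of `X` and `u` an exogenous value,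
and `p` is the value that the potential response `V_[x](u)` gives to the parents
`Pa(Y) = ⋃_{i ∈ Y} Pa i`, then on `Y` the potential response under the intervention
`x` coincides with the potential response under the intervention fixing `Pa(Y)`
to `p`. -/
theorem composition_property {n : ℕ} {D : Fin n → Type u}
    [∀ i, Fintype (D i)] [∀ i, Nonempty (D i)]
    (M : SCM n D) (Y X : Finset (Fin n)) (hXY : Disjoint X Y)
    (x : ∀ i ∈ X, D i) (u : M.U) :
    ∀ i ∈ Y, M.resp X x u i
      = M.resp (Y.biUnion M.Pa) (fun j _ => M.resp X x u j) u i := by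
  intro i hi
  by_cases hp : i ∈ Y.biUnion M.Pa
  · rw [M.resp_of_mem _ u hp]
  · rw [M.resp_of_notMem x u (Finset.disjoint_right.mp hXY hi), M.resp_of_notMem _ u hp]
    congr 1
    funext j hj
    rw [M.resp_of_mem _ u (Finset.mem_biUnion.mpr ⟨i, hi, hj⟩)]
end

section
/- Let τ be the constructive abstraction function determined by intervariable clustering ℂ and intravariable clustering 𝔻 of V_L. If X_L ⊆ V_L is a union of clusters of ℂ and x_L ∈ D_{X_L}, then the image under τ of the set {v ∈ D_{V_L} : v agrees with x_L on X_L} equals the set {w ∈ D_{V_H} : w agrees with τ(x_L) on τ(X_L)}, where τ(X_L) denotes the set of high-level variables corresponding to the clusters contained in X_L. Consequently, the high-level intervention ω_τ(X_L ← x_L) exists and equals (τ(X_L) ← τ(x_L)). -/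
set_option linter.unusedVariables false

open Classical

universe u

/-- Values chosen separately on the clusters glue to a full low-level assignment. -/
theorem InterClustering.exists_glue {n : ℕ} {D : Fin n → Type u} [∀ i, Nonempty (D i)]
    (cl : InterClustering n) (c : ∀ i : Fin cl.m, ∀ j ∈ cl.C i, D j) :
    ∃ v : ∀ j, D j, ∀ i j (hj : j ∈ cl.C i), v j = c i j hj := by
  refine ⟨fun j => if h : ∃ i, j ∈ cl.C i then c h.choose j h.choose_spec
    else Classical.arbitrary (D j), fun i j hj => ?_⟩
  have h : ∃ i, j ∈ cl.C i := ⟨i, hj⟩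
  have unique : ∀ k (hk : j ∈ cl.C k), c k j hk = c i j hj := by
    intro k hk
    obtain rfl : k = i := by
      by_contra hne
      exact Finset.disjoint_left.mp (cl.disj k i hne) hk hj
    rfl
  simp only [dif_pos h]
  exact unique _ h.choose_spec

/-- The image under `τ` of the assignments agreeing with `x` on a union of clusters. -/
theorem IntraClustering.tau_image_restrict {n : ℕ} {D : Fin n → Type u}
    [∀ i, Nonempty (D i)] {cl : InterClustering n} (intra : IntraClustering D cl)
    (S : Finset (Fin cl.m)) (x : ∀ v ∈ S.biUnion cl.C, D v) :
    intra.tau '' {v : ∀ i : Fin n, D i | ∀ j (h : j ∈ S.biUnion cl.C), v j = x j h}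
      = {w : ∀ i : Fin cl.m, intra.B i | ∀ i (hi : i ∈ S), w i = intra.tauOn S x i hi} := by
  ext w
  constructor
  · rintro ⟨v, hv, rfl⟩ i hi
    exact congrArg (intra.tc i) (funext fun j => funext fun hj => hv j _)
  · intro hw
    have lift : ∀ i, ∃ c : ∀ j ∈ cl.C i, D j, intra.tc i c = w i ∧
        ∀ (hi : i ∈ S) j (hj : j ∈ cl.C i), c j hj = x j (Finset.mem_biUnion.mpr ⟨i, hi, hj⟩) := by
      intro i
      by_cases hi : i ∈ S
      · exact ⟨fun j hj => x j (Finset.mem_biUnion.mpr ⟨i, hi, hj⟩), (hw i hi).symm,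
          fun _ _ _ => rfl⟩
      · obtain ⟨c, hc⟩ := intra.tc_surj i (w i)
        exact ⟨c, hc, fun h => absurd h hi⟩
    choose c hc hcx using lift
    obtain ⟨v, hv⟩ := cl.exists_glue c
    refine ⟨v, fun j hj => ?_, funext fun i => ?_⟩
    · obtain ⟨i, hi, hji⟩ := Finset.mem_biUnion.mp hj
      exact (hv i j hji).trans (hcx i hi j hji)
    · rw [← hc i]
      exact congrArg (intra.tc i) (funext fun j => funext fun hj => hv i j hj)

/-- If `X_L` is a union of clusters (with cluster index set `S`)
and `x_L ∈ D_{X_L}`, then the image under `τ` of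
`Rst(V_L, x_L) = {v : v agrees with x_L on X_L}` equals
`Rst(V_H, τ(x_L)) = {w : w agrees with τ(x_L) on S}`.  Consequently the high-level
intervention `ω_τ(X_L ← x_L)` exists and equals `(τ(X_L) ← τ(x_L))` (its value is
uniquely determined). -/
theorem omega_of_cluster_union {n : ℕ} {D : Fin n → Type u}
    [∀ i, Fintype (D i)] [∀ i, Nonempty (D i)]
    (cl : InterClustering n) (intra : IntraClustering D cl)
    (S : Finset (Fin cl.m)) (xL : ∀ v ∈ S.biUnion cl.C, D v) :
    (intra.tau ''
        {v : ∀ i : Fin n, D i | ∀ j (h : j ∈ S.biUnion cl.C), v j = xL j h}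
      = {w : ∀ i : Fin cl.m, intra.B i |
          ∀ i (hi : i ∈ S), w i = intra.tauOn S xL i hi}) ∧
    (∀ xH : ∀ i ∈ S, intra.B i,
      intra.tau ''
          {v : ∀ i : Fin n, D i | ∀ j (h : j ∈ S.biUnion cl.C), v j = xL j h}
        = {w : ∀ i : Fin cl.m, intra.B i | ∀ i (hi : i ∈ S), w i = xH i hi} →
      xH = intra.tauOn S xL) := by
  refine ⟨intra.tau_image_restrict S xL, fun xH h => ?_⟩
  obtain ⟨v, hv⟩ := cl.exists_glue (D := D)
    fun i j _ => if h : j ∈ S.biUnion cl.C then xL j h else Classical.arbitrary (D j)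
  have hvx : ∀ j (h : j ∈ S.biUnion cl.C), v j = xL j h := by
    intro j hj
    obtain ⟨i, hi, hji⟩ := Finset.mem_biUnion.mp hj
    rw [hv i j hji, dif_pos hj]
  have hH := h.subset ⟨v, hvx, rfl⟩
  have hT := (intra.tau_image_restrict S xL).subset ⟨v, hvx, rfl⟩
  funext i hi
  exact (hH i hi).symm.trans (hT i hi)
end

section
/- Let M_L be a finite recursive SCM over V_L with an admissible intervariable clustering ℂ. Suppose that for each cluster C_i there is a set Φ_i and a map g_i : D_{C_i} × Φ_i → D_{C_i} such that for every variable V whose parent set intersects C_i, every parent value pa of V, every φ ∈ Φ_i, and every u: f_V(pa, u) = f_V(pa', u), where pa' is obtained from pa by replacing its C_i-coordinates c by g_i(c, φ). Let 𝔻 be any intravariable clustering such that whenever two values c^(1), c^(2) ∈ D_{C_i} lie in the same block of 𝔻_{C_i}, there exists φ ∈ Φ_i with g_i(c^(1), φ) = c^(2). Then M_L satisfies the abstract invariance condition with respect to the constructive abstraction function τ determined by ℂ and 𝔻. -/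
set_option linter.unusedVariables false

open Classical

universe u

/-- The assignment agreeing with `v2` on the clusters indexed by `S` and with `v1` elsewhere. -/
noncomputable def InterClustering.hybrid {n : ℕ} {D : Fin n → Type u} (cl : InterClustering n)
    (v1 v2 : ∀ i : Fin n, D i) (S : Finset (Fin cl.m)) : ∀ i : Fin n, D i :=
  fun p => if ∃ k ∈ S, p ∈ cl.C k then v2 p else v1 p

theorem InterClustering.hybrid_apply_of_notMem {n : ℕ} {D : Fin n → Type u}
    (cl : InterClustering n) (v1 v2 : ∀ i : Fin n, D i) {S : Finset (Fin cl.m)}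
    {k : Fin cl.m} (hk : k ∉ S) {p : Fin n} (hp : p ∈ cl.C k) :
    cl.hybrid v1 v2 S p = v1 p := by
  refine if_neg ?_
  rintro ⟨l, hl, hpl⟩
  have hkl : k ≠ l := fun h => hk (h ▸ hl)
  exact Finset.disjoint_left.mp (cl.disj k l hkl) hp hpl

theorem InterClustering.hybrid_insert {n : ℕ} {D : Fin n → Type u}
    (cl : InterClustering n) (v1 v2 : ∀ i : Fin n, D i) (S : Finset (Fin cl.m))
    (k : Fin cl.m) (p : Fin n) :
    cl.hybrid v1 v2 (insert k S) p = if p ∈ cl.C k then v2 p else cl.hybrid v1 v2 S p := by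
  by_cases hp : p ∈ cl.C k <;> simp [InterClustering.hybrid, hp]

/-- **Invariance information yields the AIC.**
Let `ML` be a finite recursive SCM with admissible intervariable clustering `cl`.
Suppose for each cluster `i` there are a set `Φ i` and a map
`g i : D_{C i} × Φ i → D_{C i}` such that every mechanism of a variable whose parent
set intersects `C i` is invariant under replacing the `C i`-coordinates `c` of its
parent value by `g i c φ`.  If the intravariable clustering is such that any two
values in a common block of `𝔻_{C i}` are related by some `g i · φ`, then `ML`
satisfies the abstract invariance condition with respect to the constructive
abstraction function `τ` determined by `cl` and the intravariable clustering. -/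
theorem invariance_info_implies_AIC {n : ℕ} {D : Fin n → Type u}
    [∀ i, Fintype (D i)] [∀ i, Nonempty (D i)]
    (cl : InterClustering n) (intra : IntraClustering D cl)
    (ML : SCM n D) (hadm : cl.AdmissibleFor ML)
    (Φ : Fin cl.m → Type u)
    (g : ∀ i : Fin cl.m, (∀ j ∈ cl.C i, D j) → Φ i → (∀ j ∈ cl.C i, D j))
    (hg : ∀ (i : Fin cl.m) (V : Fin n), (∃ p ∈ ML.Pa V, p ∈ cl.C i) →
        ∀ (v : ∀ j : Fin n, D j) (φ : Φ i) (u : ML.U),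
          ML.mech V (fun p _ => v p) u
            = ML.mech V
                (fun p _ =>
                  if h : p ∈ cl.C i then g i (fun j _ => v j) φ p h else v p) u)
    (hD : ∀ (i : Fin cl.m) (c1 c2 : ∀ j ∈ cl.C i, D j),
        intra.tc i c1 = intra.tc i c2 → ∃ φ : Φ i, g i c1 φ = c2) :
    AIC ML intra := by
  intro v1 v2 hv u i
  congr 1
  funext V hV
  have key : ∀ S : Finset (Fin cl.m),
      ML.mech V (fun p _ => cl.hybrid v1 v2 S p) u = ML.mech V (fun p _ => v1 p) u := by
    intro S
    induction S using Finset.induction_on with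
    | empty => simp [InterClustering.hybrid]
    | insert k S hk ih =>
      rw [← ih]
      by_cases hpar : ∃ p ∈ ML.Pa V, p ∈ cl.C k
      · have hblock : intra.tc k (fun j _ => cl.hybrid v1 v2 S j)
            = intra.tc k (fun j _ => v2 j) := by
          rw [← show intra.tc k (fun j _ => v1 j) = intra.tc k (fun j _ => v2 j) from
            congrFun hv k]
          congr 1
          funext j hj
          exact cl.hybrid_apply_of_notMem v1 v2 hk hj
        obtain ⟨φ, hφ⟩ := hD k _ _ hblock
        rw [hg k V hpar (cl.hybrid v1 v2 S) φ u, hφ]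
        congr 1
        funext p _
        rw [cl.hybrid_insert]
        split_ifs <;> rfl
      · congr 1
        funext p hp
        rw [cl.hybrid_insert, if_neg fun h => hpar ⟨p, hp, h⟩]
  rw [← key Finset.univ]
  congr 1
  funext p hp
  obtain ⟨k, _, hk⟩ := hadm i V hV p hp
  exact if_pos ⟨k, Finset.mem_univ k, hk⟩
end

section
/- Backdoor adjustment in the nutrition model: let U_RB, U_R', U_D, U_N, U_B be finite independent random variables (with a product probability mass function), let R = f_R(U_RB, U_R'), D = f_D(R, U_D), N = f_N(D, U_N), and B = f_B(N, U_RB, U_B) for measurable maps f_R, f_D, f_N, f_B into finite domains, and let B_[D=d] := f_B(f_N(d, U_N), U_RB, U_B) denote the potential response of B under the intervention D ← d. If P(R = r, D = d) > 0 for every r with P(R = r) > 0, then for every b: P(B_[D=d] = b) = Σ_r P(B = b | R = r, D = d) · P(R = r), where the sum ranges over r with P(R = r) > 0. -/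
set_option linter.unusedVariables false

open Classical

/-- The probability of the event `E` under the mass function `μ` on the finite
sample space `Ω`. -/
noncomputable def PrI {Ω : Type*} [Fintype Ω] (μ : Ω → ℝ) (E : Ω → Prop) : ℝ :=
  ∑ ω : Ω, if E ω then μ ω else 0

theorem PrI_mono {Ω : Type*} [Fintype Ω] {μ : Ω → ℝ} (hμ : ∀ ω, 0 ≤ μ ω) {E F : Ω → Prop}
    (h : ∀ ω, E ω → F ω) : PrI μ E ≤ PrI μ F := by
  refine Finset.sum_le_sum fun ω _ => ?_
  by_cases hE : E ω
  · simp [hE, h ω hE]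
  · rw [if_neg hE]
    split_ifs
    exacts [hμ ω, le_rfl]

theorem PrI_nonneg {Ω : Type*} [Fintype Ω] {μ : Ω → ℝ} (hμ : ∀ ω, 0 ≤ μ ω) (E : Ω → Prop) :
    0 ≤ PrI μ E :=
  Finset.sum_nonneg fun ω _ => by
    split_ifs
    exacts [hμ ω, le_rfl]

/-- Law of total probability for a finite-valued variable. -/
theorem PrI_eq_sum_PrI_and_eq {Ω α : Type*} [Fintype Ω] [Fintype α] (μ : Ω → ℝ) (E : Ω → Prop)
    (X : Ω → α) : PrI μ E = ∑ x, PrI μ (fun ω => E ω ∧ X ω = x) := by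
  unfold PrI
  rw [Finset.sum_comm]
  refine Finset.sum_congr rfl fun ω _ => ?_
  by_cases hE : E ω <;> simp [hE]

/-- Under a product mass function, an event in the third coordinate is independent of any event
in the remaining coordinates. -/
theorem PrI_and_third {α β γ δ ε : Type*}
    [Fintype α] [Fintype β] [Fintype γ] [Fintype δ] [Fintype ε]
    {p : α → ℝ} {q : β → ℝ} {s : γ → ℝ} {t : δ → ℝ} {w : ε → ℝ} (hs : ∑ c, s c = 1)
    {μ : α × β × γ × δ × ε → ℝ}
    (hμ : ∀ ω, μ ω = p ω.1 * q ω.2.1 * s ω.2.2.1 * t ω.2.2.2.1 * w ω.2.2.2.2)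
    (G : α → β → δ → ε → Prop) (F : γ → Prop) :
    PrI μ (fun ω => G ω.1 ω.2.1 ω.2.2.2.1 ω.2.2.2.2 ∧ F ω.2.2.1)
      = PrI μ (fun ω => G ω.1 ω.2.1 ω.2.2.2.1 ω.2.2.2.2) * PrI s F := by
  have key : ∀ F : γ → Prop,
      PrI μ (fun ω => G ω.1 ω.2.1 ω.2.2.2.1 ω.2.2.2.2 ∧ F ω.2.2.1)
        = (∑ a, ∑ b, ∑ x, ∑ y, if G a b x y then p a * q b * t x * w y else 0) * PrI s F := by
    intro F
    simp only [PrI, Fintype.sum_prod_type, hμ, Finset.sum_mul]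
    refine Finset.sum_congr rfl fun a _ => Finset.sum_congr rfl fun b _ => ?_
    simp only [← Finset.sum_mul]
    rw [Finset.mul_sum]
    refine Finset.sum_congr rfl fun c _ => ?_
    simp only [Finset.sum_mul]
    refine Finset.sum_congr rfl fun x _ => Finset.sum_congr rfl fun y _ => ?_
    by_cases hG : G a b x y <;> by_cases hF : F c <;> simp [hG, hF]
    ring
  have htrue := key fun _ => True
  have hone : PrI s (fun _ => True) = 1 := by simpa [PrI] using hs
  simp only [and_true, hone, mul_one] at htrue
  rw [key, htrue]

/-- **Backdoor adjustment in the nutrition model.**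
Independent finite exogenous variables `U_RB, U_R', U_D, U_N, U_B` with product mass
function `μ`; mechanisms `R = fR(u_RB, u_R')`, `D = fD(R, u_D)`, `N = fN(D, u_N)`,
`B = fB(N, u_RB, u_B)`; `Bint d` is the potential response of `B` under the
intervention `D ← d`.  If `P(R = r, D = d) > 0` for every `r` with `P(R = r) > 0`,
then `P(B_[D=d] = b) = Σ_r P(B = b | R = r, D = d) · P(R = r)`, the sum ranging over
`r` with `P(R = r) > 0`. -/
theorem backdoor_adjustment_nutrition
    {URB UR' UD UN UB ΩR ΩD ΩN ΩB : Type*}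
    [Fintype URB] [Fintype UR'] [Fintype UD] [Fintype UN] [Fintype UB]
    [Fintype ΩR] [Fintype ΩD] [Fintype ΩN] [Fintype ΩB]
    (pRB : URB → ℝ) (pR' : UR' → ℝ) (pD : UD → ℝ) (pN : UN → ℝ) (pB : UB → ℝ)
    (hRB0 : ∀ u, 0 ≤ pRB u) (hR'0 : ∀ u, 0 ≤ pR' u) (hD0 : ∀ u, 0 ≤ pD u)
    (hN0 : ∀ u, 0 ≤ pN u) (hB0 : ∀ u, 0 ≤ pB u)
    (hRB1 : ∑ u : URB, pRB u = 1) (hR'1 : ∑ u : UR', pR' u = 1)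
    (hD1 : ∑ u : UD, pD u = 1) (hN1 : ∑ u : UN, pN u = 1)
    (hB1 : ∑ u : UB, pB u = 1)
    (fR : URB → UR' → ΩR) (fD : ΩR → UD → ΩD) (fN : ΩD → UN → ΩN)
    (fB : ΩN → URB → UB → ΩB)
    (μ : URB × UR' × UD × UN × UB → ℝ)
    (hμ : ∀ ω, μ ω = pRB ω.1 * pR' ω.2.1 * pD ω.2.2.1 * pN ω.2.2.2.1 * pB ω.2.2.2.2)
    (R : URB × UR' × UD × UN × UB → ΩR) (hR : ∀ ω, R ω = fR ω.1 ω.2.1)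
    (Dv : URB × UR' × UD × UN × UB → ΩD) (hDv : ∀ ω, Dv ω = fD (R ω) ω.2.2.1)
    (N : URB × UR' × UD × UN × UB → ΩN) (hN : ∀ ω, N ω = fN (Dv ω) ω.2.2.2.1)
    (B : URB × UR' × UD × UN × UB → ΩB)
    (hB : ∀ ω, B ω = fB (N ω) ω.1 ω.2.2.2.2)
    (Bint : ΩD → URB × UR' × UD × UN × UB → ΩB)
    (hBint : ∀ d ω, Bint d ω = fB (fN d ω.2.2.2.1) ω.1 ω.2.2.2.2)
    (d : ΩD) (b : ΩB)
    (hpos : ∀ r : ΩR, 0 < PrI μ (fun ω => R ω = r) →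
      0 < PrI μ (fun ω => R ω = r ∧ Dv ω = d)) :
    PrI μ (fun ω => Bint d ω = b)
      = ∑ r ∈ Finset.univ.filter (fun r : ΩR => 0 < PrI μ (fun ω => R ω = r)),
          PrI μ (fun ω => B ω = b ∧ R ω = r ∧ Dv ω = d)
              / PrI μ (fun ω => R ω = r ∧ Dv ω = d)
            * PrI μ (fun ω => R ω = r) := by
  have hμ0 : ∀ ω, 0 ≤ μ ω := fun ω => by
    rw [hμ]
    exact mul_nonneg (mul_nonneg (mul_nonneg (mul_nonneg (hRB0 _) (hR'0 _)) (hD0 _)) (hN0 _))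
      (hB0 _)
  rw [PrI_eq_sum_PrI_and_eq μ _ R]
  symm
  apply Finset.sum_subset_zero_on_sdiff (Finset.filter_subset _ _)
  · intro r hr
    have hr' : ¬ 0 < PrI μ (fun ω => R ω = r) := by simpa using hr
    exact le_antisymm ((PrI_mono hμ0 fun ω h => h.2).trans (not_lt.mp hr')) (PrI_nonneg hμ0 _)
  · intro r hr
    have hr' : 0 < PrI μ (fun ω => R ω = r) := (Finset.mem_filter.mp hr).2
    have hRD : PrI μ (fun ω => R ω = r ∧ Dv ω = d)
        = PrI μ (fun ω => R ω = r) * PrI pD (fun u => fD r u = d) := by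
      have h := PrI_and_third hD1 hμ (fun a c _ _ => fR a c = r) (fun u => fD r u = d)
      simp only [← hR] at h
      rw [← h]
      congr 1
      funext ω
      exact propext (and_congr_right fun h => by rw [hDv, h])
    have hBRD : PrI μ (fun ω => B ω = b ∧ R ω = r ∧ Dv ω = d)
        = PrI μ (fun ω => Bint d ω = b ∧ R ω = r) * PrI pD (fun u => fD r u = d) := by
      have h := PrI_and_third hD1 hμ (fun a c x y => fB (fN d x) a y = b ∧ fR a c = r)
        (fun u => fD r u = d)
      simp only [← hR, ← hBint] at h
      rw [← h]
      congr 1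
      funext ω
      refine propext ⟨?_, ?_⟩
      · rintro ⟨h1, h2, h3⟩
        exact ⟨⟨by rw [hBint, ← h3, ← hN, ← hB, h1], h2⟩, by rw [← h2, ← hDv, h3]⟩
      · rintro ⟨⟨h1, h2⟩, h3⟩
        have h4 : Dv ω = d := by rw [hDv, h2, h3]
        exact ⟨by rw [hB, hN, h4, ← hBint, h1], h2, h4⟩
    have hne := (hpos r hr').ne'
    rw [hRD] at hne
    have hS := right_ne_zero_of_mul hne
    have hP := hr'.ne'
    rw [hRD, hBRD]
    field_simp
end

section
/- Backdoor adjustment under confounded labels: let U_CD, U_C, U_D, U_I be finite independent random variables (with a product probability mass function), let C = f_C(U_CD, U_C), D = f_D(U_CD, U_D), and I = f_I(C, D, U_I) for measurable maps into finite domains, and let I_[D=d] := f_I(C, d, U_I) denote the potential response of I under the intervention D ← d. If P(C = c, D = d) > 0 for every c with P(C = c) > 0, then for every i: P(I_[D=d] = i) = Σ_c P(I = i | C = c, D = d) · P(C = c), where the sum ranges over c with P(C = c) > 0. -/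
set_option linter.unusedVariables false

open Classical

theorem PrI_eq_sum_fiber {Ω α : Type*} [Fintype Ω] [Fintype α] (μ : Ω → ℝ) (X : Ω → α)
    (E : Ω → Prop) : PrI μ E = ∑ a, PrI μ (fun ω => X ω = a ∧ E ω) := by
  unfold PrI
  rw [Finset.sum_comm]
  refine Finset.sum_congr rfl fun ω _ => ?_
  by_cases h : E ω <;> simp [h]

theorem PrI_and_last {α β γ δ : Type*} [Fintype α] [Fintype β] [Fintype γ] [Fintype δ]
    {μ : α × β × γ × δ → ℝ} {p : α → β → γ → ℝ} {q : δ → ℝ} (hq : ∑ u, q u = 1)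
    (hμ : ∀ ω, μ ω = p ω.1 ω.2.1 ω.2.2.1 * q ω.2.2.2)
    (A : α → β → γ → Prop) (B : δ → Prop) :
    PrI μ (fun ω => A ω.1 ω.2.1 ω.2.2.1 ∧ B ω.2.2.2)
      = PrI μ (fun ω => A ω.1 ω.2.1 ω.2.2.1) * PrI q B := by
  simp only [PrI, Fintype.sum_prod_type, hμ, Finset.sum_mul]
  refine Finset.sum_congr rfl fun a _ => Finset.sum_congr rfl fun b _ =>
    Finset.sum_congr rfl fun c _ => ?_
  by_cases h : A a b c
  · simp only [h, true_and, if_true, ← Finset.mul_sum, hq, ← Finset.sum_mul, mul_one]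
    rw [Finset.mul_sum]
    exact Finset.sum_congr rfl fun u _ => by split_ifs <;> simp
  · simp [h]

/-- **Backdoor adjustment under confounded labels.**
Independent finite exogenous variables `U_CD, U_C, U_D, U_I` with product mass
function `μ`; mechanisms `C = fC(u_CD, u_C)`, `D = fD(u_CD, u_D)`,
`I = fI(C, D, u_I)`; `Iint d` is the potential response of `I` under the intervention
`D ← d`.  If `P(C = c, D = d) > 0` for every `c` with `P(C = c) > 0`, then
`P(I_[D=d] = i) = Σ_c P(I = i | C = c, D = d) · P(C = c)`, the sum ranging over `c`
with `P(C = c) > 0`. -/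
theorem backdoor_adjustment_confounded_labels
    {UCD UC UD UI ΩC ΩD ΩI : Type*}
    [Fintype UCD] [Fintype UC] [Fintype UD] [Fintype UI]
    [Fintype ΩC] [Fintype ΩD] [Fintype ΩI]
    (pCD : UCD → ℝ) (pC : UC → ℝ) (pD : UD → ℝ) (pI : UI → ℝ)
    (hCD0 : ∀ u, 0 ≤ pCD u) (hC0 : ∀ u, 0 ≤ pC u) (hD0 : ∀ u, 0 ≤ pD u)
    (hI0 : ∀ u, 0 ≤ pI u)
    (hCD1 : ∑ u : UCD, pCD u = 1) (hC1 : ∑ u : UC, pC u = 1)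
    (hD1 : ∑ u : UD, pD u = 1) (hI1 : ∑ u : UI, pI u = 1)
    (fC : UCD → UC → ΩC) (fD : UCD → UD → ΩD) (fI : ΩC → ΩD → UI → ΩI)
    (μ : UCD × UC × UD × UI → ℝ)
    (hμ : ∀ ω, μ ω = pCD ω.1 * pC ω.2.1 * pD ω.2.2.1 * pI ω.2.2.2)
    (C : UCD × UC × UD × UI → ΩC) (hC : ∀ ω, C ω = fC ω.1 ω.2.1)
    (Dv : UCD × UC × UD × UI → ΩD) (hDv : ∀ ω, Dv ω = fD ω.1 ω.2.2.1)
    (I : UCD × UC × UD × UI → ΩI) (hI : ∀ ω, I ω = fI (C ω) (Dv ω) ω.2.2.2)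
    (Iint : ΩD → UCD × UC × UD × UI → ΩI)
    (hIint : ∀ d ω, Iint d ω = fI (C ω) d ω.2.2.2)
    (d : ΩD) (i : ΩI)
    (hpos : ∀ c : ΩC, 0 < PrI μ (fun ω => C ω = c) →
      0 < PrI μ (fun ω => C ω = c ∧ Dv ω = d)) :
    PrI μ (fun ω => Iint d ω = i)
      = ∑ c ∈ Finset.univ.filter (fun c : ΩC => 0 < PrI μ (fun ω => C ω = c)),
          PrI μ (fun ω => I ω = i ∧ C ω = c ∧ Dv ω = d)
              / PrI μ (fun ω => C ω = c ∧ Dv ω = d)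
            * PrI μ (fun ω => C ω = c) := by
  have hμ0 : ∀ ω, 0 ≤ μ ω := fun ω => by
    rw [hμ]
    exact mul_nonneg (mul_nonneg (mul_nonneg (hCD0 _) (hC0 _)) (hD0 _)) (hI0 _)
  have response : ∀ c, PrI μ (fun ω => C ω = c ∧ Iint d ω = i)
      = PrI μ (fun ω => C ω = c) * PrI pI (fun u => fI c d u = i) := fun c => by
    have key := PrI_and_last (p := fun a b e => pCD a * pC b * pD e) hI1 hμ
      (fun a b _ => fC a b = c) (fun u => fI c d u = i)
    simp only [← hC] at key
    rw [← key]
    congr 1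
    funext ω
    exact propext (and_congr_right fun h => by rw [hIint, h])
  have observed : ∀ c, PrI μ (fun ω => I ω = i ∧ C ω = c ∧ Dv ω = d)
      = PrI μ (fun ω => C ω = c ∧ Dv ω = d) * PrI pI (fun u => fI c d u = i) := fun c => by
    have key := PrI_and_last (p := fun a b e => pCD a * pC b * pD e) hI1 hμ
      (fun a b e => fC a b = c ∧ fD a e = d) (fun u => fI c d u = i)
    simp only [← hC, ← hDv] at key
    rw [← key]
    congr 1
    funext ω
    rw [and_comm]
    exact propext (and_congr_right fun h => by rw [hI, h.1, h.2])
  rw [PrI_eq_sum_fiber μ C, Finset.sum_filter]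
  refine Finset.sum_congr rfl fun c _ => ?_
  rw [response]
  split_ifs with hc
  · rw [observed, mul_div_cancel_left₀ _ (hpos c hc).ne', mul_comm]
  · rw [le_antisymm (not_lt.mp hc) (PrI_nonneg hμ0 _), zero_mul]
end
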